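/- For every T > 0, every H ∈ (0,1) with H ≠ 1/2, and all i, j ∈ ℕ, the coefficients K_{ij}^H satisfy the expanded formula K_{ij}^H = a_H · Γ(1/2 - H) · √((2j+1)/T) · F_i^{H+1/2} · Σ_{k=0}^j (-1)^{j-k} · ( (1/2 - H + k)/(H + 1/2 + k) ) · Π_k^{(ij)}, where Π_0^{(ij)} = 1 and Π_k^{(ij)} = [ (H+1/2+k)² (k - 1/2 - H) / k³ ] · [ (j-k+1)/(H+1/2-i+k) ] · [ (j+k)/(H+1/2+i+k+1) ] · Π_{k-1}^{(ij)} for k = 1, 2, … -/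

import Mathlib

open MeasureTheory Finset

/-- Coefficients of the shifted Legendre polynomials:
`l_{ik} = (-1)^(i-k) * C(i+k, i) * C(i, i-k)`. -/
noncomputable def legCoef (i k : ℕ) : ℝ :=
  (-1 : ℝ) ^ (i - k) * (Nat.choose (i + k) i : ℝ) * (Nat.choose i (i - k) : ℝ)

/-- Shifted Legendre polynomials on `[0, T]`, orthonormal in `L²([0,T])`:
`P̂(i,t) = √((2i+1)/T) · Σ_{k=0}^i l_{ik} (t/T)^k`. -/
noncomputable def legP (T : ℝ) (i : ℕ) (t : ℝ) : ℝ :=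
  Real.sqrt ((2 * i + 1) / T) * ∑ k ∈ Finset.range (i + 1), legCoef i k * (t / T) ^ k

/-- `F_i^α = ∫₀^T t^α P̂(i,t) dt`, the expansion coefficient of the power function
`t ↦ t^α` relative to the `i`-th Legendre polynomial. -/
noncomputable def Fcoef (T α : ℝ) (i : ℕ) : ℝ :=
  ∫ t in (0:ℝ)..T, t ^ α * legP T i t

/-- Rising factorial `x^{\overline{k}} = x(x+1)⋯(x+k-1)`. -/
noncomputable def riseFac (x : ℝ) (k : ℕ) : ℝ :=
  ∏ m ∈ Finset.range k, (x + m)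

/-- Left-sided Riemann–Liouville fractional integral of order `β`:
`(J^β φ)(t) = (1/Γ(β)) ∫₀^t φ(τ)(t-τ)^{β-1} dτ`. -/
noncomputable def rlInt (β : ℝ) (φ : ℝ → ℝ) (t : ℝ) : ℝ :=
  (1 / Real.Gamma β) * ∫ τ in (0:ℝ)..t, φ τ * (t - τ) ^ (β - 1)

/-- `a_H = √(2H·Γ(H+1/2)·Γ(3/2-H)/Γ(2-2H))`. -/
noncomputable def aH (H : ℝ) : ℝ :=
  Real.sqrt (2 * H * Real.Gamma (H + 1/2) * Real.Gamma (3/2 - H) / Real.Gamma (2 - 2 * H))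

open scoped Classical in
/-- The operator `𝒦_H` corresponding to the kernel of the integral representation of the
fractional Brownian motion with Hurst index `H`. -/
noncomputable def Kop (H : ℝ) (φ : ℝ → ℝ) (t : ℝ) : ℝ :=
  if H < 1/2 then
    aH H * rlInt (2 * H)
      (fun s => s ^ ((1:ℝ)/2 - H) * rlInt ((1:ℝ)/2 - H) (fun τ => τ ^ (H - 1/2) * φ τ) s) t
  else if 1/2 < H then
    aH H * rlInt 1
      (fun s => s ^ (H - (1:ℝ)/2) * rlInt (H - (1:ℝ)/2) (fun τ => τ ^ ((1:ℝ)/2 - H) * φ τ) s) t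
  else ∫ τ in (0:ℝ)..t, φ τ

/-- `K_{ij}^H = ∫₀^T P̂(i,t) (𝒦_H P̂(j,·))(t) dt`, the expansion coefficients of the
fractional Brownian motion kernel relative to the Legendre polynomials on `[0,T]`. -/
noncomputable def Kcoef (T H : ℝ) (i j : ℕ) : ℝ :=
  ∫ t in (0:ℝ)..T, legP T i t * Kop H (legP T j) t

theorem legCoef_succ {i k : ℕ} (h : k < i) :
    legCoef i (k + 1) * ((k : ℝ) + 1) ^ 2 = -(((i : ℝ) + k + 1) * (i - k)) * legCoef i k := by
  have hpow : (-1 : ℝ) ^ (i - k) = -(-1 : ℝ) ^ (i - (k + 1)) := by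
    rw [show i - k = i - (k + 1) + 1 by omega, pow_succ]
    ring
  have h₁ : ((i + k).choose i : ℝ) * (i + k + 1) = (i + (k + 1)).choose i * (k + 1) := by
    have := Nat.choose_mul_succ_eq (i + k) i
    rw [show i + k + 1 - i = k + 1 by omega] at this
    exact_mod_cast this
  have h₂ : (i.choose (i - (k + 1)) : ℝ) * (k + 1) = i.choose (i - k) * (i - k) := by
    have := Nat.choose_succ_right_eq i k
    rw [← Nat.choose_symm h.le, ← Nat.choose_symm (show k + 1 ≤ i from h)] at this
    have hc : ((i - k : ℕ) : ℝ) = (i : ℝ) - k := Nat.cast_sub h.le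
    rw [← hc]
    exact_mod_cast this
  unfold legCoef
  rw [hpow]
  linear_combination (-((-1 : ℝ) ^ (i - (k + 1))) * (i.choose (i - (k + 1)) : ℝ) * (k + 1)) * h₁ +
    ((-1 : ℝ) ^ (i - (k + 1)) * ((i + k).choose i : ℝ) * (i + k + 1)) * h₂

theorem legCoef_eq_prod {j k : ℕ} (h : k ≤ j) :
    legCoef j k = (-1 : ℝ) ^ (j - k) *
      ∏ m ∈ Finset.Icc 1 k, ((j : ℝ) - m + 1) * (j + m) / (m : ℝ) ^ 2 := by
  induction k with
  | zero => simp [legCoef]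
  | succ k ih =>
    have hk : ((k : ℝ) + 1) ^ 2 ≠ 0 := by positivity
    have hpow : (-1 : ℝ) ^ (j - k) = -(-1 : ℝ) ^ (j - (k + 1)) := by
      rw [show j - k = j - (k + 1) + 1 by omega, pow_succ]
      ring
    rw [eq_div_of_mul_eq hk (legCoef_succ h), ih (by omega), hpow,
      Finset.prod_Icc_succ_top (by omega)]
    push_cast
    ring

/-- The first-order recurrence in `x` satisfied by the partial fraction expansion
`∑ l_{im} / (x + m + 1)`. -/
theorem sum_legCoef_div_add_one {x : ℝ} (hx : -1 < x) (i : ℕ) :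
    (∑ m ∈ Finset.range (i + 1), legCoef i m / (x + 1 + m + 1)) * ((x + 1 - i) * (x + i + 2)) =
      (∑ m ∈ Finset.range (i + 1), legCoef i m / (x + m + 1)) * (x + 1) ^ 2 := by
  have hl : (∑ m ∈ Finset.range (i + 1), legCoef i m / (x + 1 + m + 1)) *
      ((x + 1 - i) * (x + i + 2)) =
      ∑ m ∈ Finset.range (i + 1), legCoef i m * (x + 1 - m) +
      ∑ m ∈ Finset.range (i + 1), legCoef i m * ((m + 1 + i) * (m - i)) / (x + 1 + m + 1) := by
    rw [Finset.sum_mul, ← Finset.sum_add_distrib]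
    refine Finset.sum_congr rfl fun m _ => ?_
    have : x + 1 + m + 1 ≠ 0 := ne_of_gt <| by linarith [m.cast_nonneg (α := ℝ)]
    field_simp
    ring
  have hr : (∑ m ∈ Finset.range (i + 1), legCoef i m / (x + m + 1)) * (x + 1) ^ 2 =
      ∑ m ∈ Finset.range (i + 1), legCoef i m * (x + 1 - m) +
      ∑ m ∈ Finset.range (i + 1), legCoef i m * (m : ℝ) ^ 2 / (x + m + 1) := by
    rw [Finset.sum_mul, ← Finset.sum_add_distrib]
    refine Finset.sum_congr rfl fun m _ => ?_
    have : x + m + 1 ≠ 0 := ne_of_gt <| by linarith [m.cast_nonneg (α := ℝ)]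
    field_simp
    ring
  rw [hl, hr, Finset.sum_range_succ (fun m => legCoef i m * ((m + 1 + i) * (m - i)) / _),
    Finset.sum_range_succ' (fun m => legCoef i m * (m : ℝ) ^ 2 / _)]
  simp only [sub_self, mul_zero, zero_div, add_zero, Nat.cast_zero, ne_eq, OfNat.ofNat_ne_zero,
    not_false_eq_true, zero_pow]
  congr 1
  refine Finset.sum_congr rfl fun m hm => ?_
  have hrec := legCoef_succ (Finset.mem_range.mp hm)
  push_cast
  rw [hrec]
  congr 1 <;> ring

theorem legP_eq_sum (T : ℝ) (i : ℕ) (t : ℝ) :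
    legP T i t = ∑ k ∈ Finset.range (i + 1),
      Real.sqrt ((2 * i + 1) / T) * legCoef i k / T ^ k * t ^ k := by
  rw [legP, Finset.mul_sum]
  refine Finset.sum_congr rfl fun k _ => ?_
  rw [div_pow]
  ring

theorem continuous_legP (T : ℝ) (i : ℕ) : Continuous (legP T i) := by
  unfold legP
  fun_prop

theorem intervalIntegrable_rpow_mul_legP {α : ℝ} (hα : -1 < α) (T : ℝ) (i : ℕ) :
    IntervalIntegrable (fun t => t ^ α * legP T i t) volume 0 T :=
  (intervalIntegral.intervalIntegrable_rpow' hα).mul_continuousOn (continuous_legP T i).continuousOn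

theorem Fcoef_eq_sum {T α : ℝ} (hT : 0 < T) (hα : -1 < α) (i : ℕ) :
    Fcoef T α i = Real.sqrt ((2 * i + 1) / T) * T ^ (α + 1) *
      ∑ m ∈ Finset.range (i + 1), legCoef i m / (α + m + 1) := by
  have hm (m : ℕ) : -1 < α + m := by linarith [m.cast_nonneg (α := ℝ)]
  have hint : ∀ m ∈ Finset.range (i + 1), IntervalIntegrable
      (fun t : ℝ => Real.sqrt ((2 * i + 1) / T) * legCoef i m / T ^ m * t ^ (α + m))
      volume 0 T := fun m _ => (intervalIntegral.intervalIntegrable_rpow' (hm m)).const_mul _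
  have hcongr : Fcoef T α i = ∫ t in (0 : ℝ)..T, ∑ m ∈ Finset.range (i + 1),
      Real.sqrt ((2 * i + 1) / T) * legCoef i m / T ^ m * t ^ (α + m) := by
    refine intervalIntegral.integral_congr_Ioo_of_le hT.le fun t ht => ?_
    simp only [legP_eq_sum, Finset.mul_sum]
    refine Finset.sum_congr rfl fun m _ => ?_
    rw [Real.rpow_add_natCast ht.1.ne']
    ring
  rw [hcongr, intervalIntegral.integral_finsetSum hint, Finset.mul_sum]
  refine Finset.sum_congr rfl fun m _ => ?_
  rw [intervalIntegral.integral_const_mul, integral_rpow (Or.inl (hm m)),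
    Real.zero_rpow (by linarith [hm m]), show α + m + 1 = α + 1 + m by ring,
    Real.rpow_add_natCast hT.ne']
  field_simp
  ring

theorem Fcoef_add_natCast {T α : ℝ} (hT : 0 < T) (hα : -1 < α) (hα' : ∀ n : ℤ, α ≠ n) (i k : ℕ) :
    Fcoef T (α + k) i = T ^ k * Fcoef T α i *
      ∏ m ∈ Finset.Icc 1 k, (α + m) ^ 2 / ((α - i + m) * (α + i + m + 1)) := by
  induction k with
  | zero => simp
  | succ k ih =>
    have hk : -1 < α + k := by linarith [k.cast_nonneg (α := ℝ)]
    have h₁ : α - i + (k + 1) ≠ 0 := fun h => hα' (i - (k + 1)) (by push_cast; linarith)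
    have h₂ : α + i + (k + 1) + 1 ≠ 0 :=
      ne_of_gt <| by linarith [i.cast_nonneg (α := ℝ)]
    have hrec := sum_legCoef_div_add_one hk i
    have hF : Fcoef T (α + (k + 1)) i =
        T * Fcoef T (α + k) i * ((α + (k + 1)) ^ 2 / ((α - i + (k + 1)) * (α + i + (k + 1) + 1))) := by
      rw [← mul_div_assoc, eq_div_iff (mul_ne_zero h₁ h₂), ← add_assoc,
        Fcoef_eq_sum hT (by linarith), Fcoef_eq_sum hT hk, Real.rpow_add_one hT.ne']
      linear_combination (Real.sqrt ((2 * i + 1) / T) * (T ^ (α + k + 1) * T)) * hrec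
    rw [Finset.prod_Icc_succ_top (by omega)]
    push_cast
    rw [hF, ih]
    ring

theorem Gamma_add_one_add_natCast {x : ℝ} (hx : ∀ n : ℤ, x ≠ n) (k : ℕ) :
    Real.Gamma (x + 1 + k) =
      Real.Gamma x * (x + k) * ∏ m ∈ Finset.Icc 1 k, (x + m - 1) := by
  have hne (n : ℕ) : x + n ≠ 0 := fun h => hx (-n) (by push_cast; linarith)
  induction k with
  | zero => simpa [mul_comm] using Real.Gamma_add_one (by simpa using hne 0)
  | succ k ih =>
    have h := Real.Gamma_add_one (hne (k + 1))
    push_cast at h ⊢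
    rw [Finset.prod_Icc_succ_top (by omega), show x + 1 + (k + 1 : ℝ) = x + (k + 1) + 1 by ring, h,
      show x + (k + 1 : ℝ) = x + 1 + k by ring, ih]
    push_cast
    ring

theorem factorial_eq_prod_Icc (k : ℕ) : (k.factorial : ℝ) = ∏ m ∈ Finset.Icc 1 k, (m : ℝ) := by
  induction k with
  | zero => simp
  | succ k ih =>
    rw [Finset.prod_Icc_succ_top (by omega), ← ih, Nat.factorial_succ]
    push_cast
    ring

theorem integral_rpow_mul_sub_rpow {u v t : ℝ} (hu : 0 < u) (hv : 0 < v) (ht : 0 < t) :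
    ∫ x in (0 : ℝ)..t, x ^ (u - 1) * (t - x) ^ (v - 1) =
      t ^ (u + v - 1) * (Real.Gamma u * Real.Gamma v / Real.Gamma (u + v)) := by
  have h := Complex.betaIntegral_scaled u v ht
  rw [Complex.betaIntegral_eq_Gamma_mul_div _ _ (by simpa) (by simpa)] at h
  have hl : ∫ x in (0 : ℝ)..t, (x : ℂ) ^ ((u : ℂ) - 1) * ((t : ℂ) - x) ^ ((v : ℂ) - 1) =
      ∫ x in (0 : ℝ)..t, ((x ^ (u - 1) * (t - x) ^ (v - 1) : ℝ) : ℂ) := by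
    refine intervalIntegral.integral_congr_Ioo_of_le ht.le fun x hx => ?_
    rw [Complex.ofReal_mul, Complex.ofReal_cpow hx.1.le, Complex.ofReal_cpow (sub_nonneg.2 hx.2.le)]
    push_cast
    rfl
  rw [hl, intervalIntegral.integral_ofReal] at h
  have hp := Complex.ofReal_cpow ht.le (u + v - 1)
  push_cast at hp
  rw [← hp, ← Complex.ofReal_add, Complex.Gamma_ofReal, Complex.Gamma_ofReal,
    Complex.Gamma_ofReal] at h
  exact_mod_cast h

theorem intervalIntegrable_rpow_mul_sub_rpow {u v t : ℝ} (hu : 0 < u) (hv : 0 < v) (ht : 0 < t) :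
    IntervalIntegrable (fun x => x ^ (u - 1) * (t - x) ^ (v - 1)) volume 0 t := by
  refine intervalIntegral.intervalIntegrable_of_integral_ne_zero ?_
  rw [integral_rpow_mul_sub_rpow hu hv ht]
  have := Real.Gamma_pos_of_pos hu
  have := Real.Gamma_pos_of_pos hv
  have := Real.Gamma_pos_of_pos (add_pos hu hv)
  positivity

/-- The Riemann–Liouville integral of a finite combination of powers. -/
theorem rlInt_sum_rpow {β t : ℝ} (hβ : 0 < β) (ht : 0 < t) {ι : Type*} (s : Finset ι)
    (b α : ι → ℝ) (hα : ∀ k ∈ s, -1 < α k) {φ : ℝ → ℝ}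
    (hφ : ∀ x ∈ Set.Ioo 0 t, φ x = ∑ k ∈ s, b k * x ^ α k) :
    rlInt β φ t = ∑ k ∈ s,
      b k * (Real.Gamma (α k + 1) / Real.Gamma (α k + 1 + β)) * t ^ (α k + β) := by
  have hcongr : ∫ x in (0 : ℝ)..t, φ x * (t - x) ^ (β - 1) =
      ∫ x in (0 : ℝ)..t, ∑ k ∈ s, b k * (x ^ (α k + 1 - 1) * (t - x) ^ (β - 1)) := by
    refine intervalIntegral.integral_congr_Ioo_of_le ht.le fun x hx => ?_
    simp only [hφ x hx, Finset.sum_mul, add_sub_cancel_right, mul_assoc]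
  have hpos : ∀ k ∈ s, 0 < α k + 1 := fun k hk => by linarith [hα k hk]
  rw [rlInt, hcongr, intervalIntegral.integral_finsetSum fun k hk =>
    (intervalIntegrable_rpow_mul_sub_rpow (hpos k hk) hβ ht).const_mul _, Finset.mul_sum]
  refine Finset.sum_congr rfl fun k hk => ?_
  have := (Real.Gamma_pos_of_pos hβ).ne'
  rw [intervalIntegral.integral_const_mul, integral_rpow_mul_sub_rpow (hpos k hk) hβ ht,
    show α k + 1 + β - 1 = α k + β by ring]
  field_simp

/-- Two nested Riemann–Liouville integrals with power weights, applied to a polynomial. -/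
theorem rlInt_rpow_mul_rlInt_polynomial {β γ t : ℝ} (hβ : 0 < β) (hγ : 0 < γ) (hγ' : γ < 1)
    (ht : 0 < t) (n : ℕ) (b : ℕ → ℝ) {φ : ℝ → ℝ}
    (hφ : ∀ x, φ x = ∑ k ∈ Finset.range n, b k * x ^ k) :
    rlInt β (fun s => s ^ γ * rlInt γ (fun x => x ^ (-γ) * φ x) s) t =
      ∑ k ∈ Finset.range n, b k * (Real.Gamma (1 - γ + k) / k.factorial) *
        (Real.Gamma (1 + γ + k) / Real.Gamma (1 + γ + β + k)) * t ^ (γ + β + k) := by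
  have hinner : ∀ s ∈ Set.Ioo 0 t, s ^ γ * rlInt γ (fun x => x ^ (-γ) * φ x) s =
      ∑ k ∈ Finset.range n, b k * (Real.Gamma (1 - γ + k) / k.factorial) * s ^ (γ + k) := by
    intro s hs
    rw [rlInt_sum_rpow hγ hs.1 (Finset.range n) b (fun k => -γ + k)
      (fun k _ => by linarith [k.cast_nonneg (α := ℝ)]) (fun x hx => ?_), Finset.mul_sum]
    · refine Finset.sum_congr rfl fun k _ => ?_
      rw [Real.rpow_add hs.1 γ, show -γ + (k : ℝ) + γ = k by ring,
        show -γ + (k : ℝ) + 1 + γ = k + 1 by ring, Real.Gamma_nat_eq_factorial,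
        show -γ + (k : ℝ) + 1 = 1 - γ + k by ring]
      ring
    · rw [hφ, Finset.mul_sum]
      refine Finset.sum_congr rfl fun k _ => ?_
      rw [Real.rpow_add_natCast hx.1.ne']
      ring
  rw [rlInt_sum_rpow hβ ht (Finset.range n) _ (fun k => γ + k)
    (fun k _ => by linarith [k.cast_nonneg (α := ℝ)]) hinner]
  refine Finset.sum_congr rfl fun k _ => ?_
  rw [show γ + (k : ℝ) + 1 = 1 + γ + k by ring, show 1 + γ + (k : ℝ) + β = 1 + γ + β + k by ring,
    show γ + (k : ℝ) + β = γ + β + k by ring]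

theorem Kop_polynomial {H t : ℝ} (hH : H ∈ Set.Ioo (0 : ℝ) 1) (hH' : H ≠ 1 / 2) (ht : 0 < t)
    (n : ℕ) (b : ℕ → ℝ) {φ : ℝ → ℝ} (hφ : ∀ x, φ x = ∑ k ∈ Finset.range n, b k * x ^ k) :
    Kop H φ t = aH H * ∑ k ∈ Finset.range n,
      b k * (Real.Gamma (3 / 2 - H + k) / (k.factorial * (H + 1 / 2 + k))) *
        t ^ (H + 1 / 2 + k) := by
  obtain ⟨h₀, h₁⟩ := hH
  rcases lt_or_gt_of_ne hH' with h | h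
  · rw [Kop, if_pos h, show H - 1 / 2 = -(1 / 2 - H) by ring,
      rlInt_rpow_mul_rlInt_polynomial (by linarith) (by linarith) (by linarith) ht n b hφ]
    congr 1
    refine Finset.sum_congr rfl fun k _ => ?_
    have hpos : 0 < H + 1 / 2 + k := by positivity
    have hΓ := (Real.Gamma_pos_of_pos hpos).ne'
    rw [show 1 - (1 / 2 - H) + (k : ℝ) = H + 1 / 2 + k by ring,
      show 1 + (1 / 2 - H) + 2 * H + (k : ℝ) = H + 1 / 2 + k + 1 by ring,
      show 1 / 2 - H + 2 * H + (k : ℝ) = H + 1 / 2 + k by ring,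
      show 1 + (1 / 2 - H) + (k : ℝ) = 3 / 2 - H + k by ring, Real.Gamma_add_one hpos.ne']
    field_simp
  · rw [Kop, if_neg h.not_gt, if_pos h, show 1 / 2 - H = -(H - 1 / 2) by ring,
      rlInt_rpow_mul_rlInt_polynomial (by linarith) (by linarith) (by linarith) ht n b hφ]
    congr 1
    refine Finset.sum_congr rfl fun k _ => ?_
    have hpos : 0 < H + 1 / 2 + k := by positivity
    have hΓ := (Real.Gamma_pos_of_pos hpos).ne'
    rw [show 1 - (H - 1 / 2) + (k : ℝ) = 3 / 2 - H + k by ring,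
      show 1 + (H - 1 / 2) + 1 + (k : ℝ) = H + 1 / 2 + k + 1 by ring,
      show H - 1 / 2 + 1 + (k : ℝ) = H + 1 / 2 + k by ring,
      show 1 + (H - 1 / 2) + (k : ℝ) = H + 1 / 2 + k by ring, Real.Gamma_add_one hpos.ne']
    field_simp

theorem Kcoef_eq_sum_Fcoef {T H : ℝ} (hT : 0 < T) (hH : H ∈ Set.Ioo (0 : ℝ) 1) (hH' : H ≠ 1 / 2)
    (i j : ℕ) :
    Kcoef T H i j = ∑ k ∈ Finset.range (j + 1),
      aH H * (Real.sqrt ((2 * j + 1) / T) * legCoef j k / T ^ k *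
        (Real.Gamma (3 / 2 - H + k) / (k.factorial * (H + 1 / 2 + k)))) *
        Fcoef T (H + 1 / 2 + k) i := by
  have hα (k : ℕ) : -1 < H + 1 / 2 + k := by linarith [hH.1, k.cast_nonneg (α := ℝ)]
  have hcongr : Kcoef T H i j = ∫ t in (0 : ℝ)..T, ∑ k ∈ Finset.range (j + 1),
      aH H * (Real.sqrt ((2 * j + 1) / T) * legCoef j k / T ^ k *
        (Real.Gamma (3 / 2 - H + k) / (k.factorial * (H + 1 / 2 + k)))) *
        (t ^ (H + 1 / 2 + k) * legP T i t) := by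
    refine intervalIntegral.integral_congr_Ioo_of_le hT.le fun t ht => ?_
    simp only [Kop_polynomial hH hH' ht.1 _ _ (legP_eq_sum T j), Finset.mul_sum]
    exact Finset.sum_congr rfl fun k _ => by ring
  rw [hcongr, intervalIntegral.integral_finsetSum fun k _ =>
    (intervalIntegrable_rpow_mul_legP (hα k) T i).const_mul _]
  exact Finset.sum_congr rfl fun k _ => intervalIntegral.integral_const_mul _ _

/-- Theorem 1, expanded formula: for `H ∈ (0,1)`, `H ≠ 1/2`,
`K_{ij}^H = a_H Γ(1/2-H) √((2j+1)/T) F_i^{H+1/2}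
  Σ_{k=0}^j (-1)^{j-k} (1/2-H+k)/(H+1/2+k) Π_k^{(ij)}`,
where `Π_0^{(ij)} = 1` and
`Π_k^{(ij)} = [(H+1/2+k)²(k-1/2-H)/k³]·[(j-k+1)/(H+1/2-i+k)]·[(j+k)/(H+1/2+i+k+1)]·Π_{k-1}^{(ij)}`,
i.e. `Π_k^{(ij)}` is the product over `m = 1, …, k` of these factors. -/
theorem Kcoef_expanded_formula (T : ℝ) (hT : 0 < T) (H : ℝ) (hH : H ∈ Set.Ioo (0:ℝ) 1)
    (hH' : H ≠ 1/2) (i j : ℕ) :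
    Kcoef T H i j =
      aH H * Real.Gamma (1/2 - H) * Real.sqrt ((2 * j + 1) / T) * Fcoef T (H + 1/2) i *
        ∑ k ∈ Finset.range (j + 1),
          (-1 : ℝ) ^ (j - k) * ((1/2 - H + k) / (H + 1/2 + k)) *
            ∏ m ∈ Finset.Icc 1 k,
              ((H + 1/2 + m) ^ 2 * ((m : ℝ) - 1/2 - H) / (m : ℝ) ^ 3 *
                (((j : ℝ) - m + 1) / (H + 1/2 - i + m)) *
                (((j : ℝ) + m) / (H + 1/2 + i + m + 1))) := by
  have hne (n : ℤ) : H + 1 / 2 ≠ n := by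
    intro h
    have h₁ : (0 : ℝ) < n := by linarith [hH.1]
    have h₂ : (n : ℝ) < 2 := by linarith [hH.2]
    have h₃ : n = 1 := by
      have : 0 < n := by exact_mod_cast h₁
      have : n < 2 := by exact_mod_cast h₂
      omega
    rw [h₃] at h
    exact hH' (by push_cast at h; linarith)
  have hne' (n : ℤ) : 1 / 2 - H ≠ n := fun h => hne (1 - n) (by push_cast; linarith)
  rw [Kcoef_eq_sum_Fcoef hT hH hH', Finset.mul_sum]
  refine Finset.sum_congr rfl fun k hk => ?_
  have hprod : ∏ m ∈ Finset.Icc 1 k,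
      ((H + 1/2 + m) ^ 2 * ((m : ℝ) - 1/2 - H) / (m : ℝ) ^ 3 *
        (((j : ℝ) - m + 1) / (H + 1/2 - i + m)) * (((j : ℝ) + m) / (H + 1/2 + i + m + 1))) =
      (∏ m ∈ Finset.Icc 1 k, ((j : ℝ) - m + 1) * (j + m) / (m : ℝ) ^ 2) *
        (∏ m ∈ Finset.Icc 1 k, (1 / 2 - H + m - 1)) / (∏ m ∈ Finset.Icc 1 k, (m : ℝ)) *
        ∏ m ∈ Finset.Icc 1 k,
          (H + 1 / 2 + m) ^ 2 / ((H + 1 / 2 - i + m) * (H + 1 / 2 + i + m + 1)) := by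
    rw [← Finset.prod_mul_distrib, ← Finset.prod_div_distrib, ← Finset.prod_mul_distrib]
    exact Finset.prod_congr rfl fun m _ => by
      rw [show 1 / 2 - H + (m : ℝ) - 1 = m - 1 / 2 - H by ring]
      simp only [div_eq_mul_inv, mul_inv]
      ring
  rw [hprod, legCoef_eq_prod (Nat.lt_succ_iff.mp (Finset.mem_range.mp hk)),
    Fcoef_add_natCast hT (by linarith [hH.1]) hne, show 3 / 2 - H = 1 / 2 - H + 1 by ring,
    Gamma_add_one_add_natCast hne', factorial_eq_prod_Icc]
  have hTk : T ^ k * (T ^ k)⁻¹ = 1 := mul_inv_cancel₀ (by positivity)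
  generalize (∏ m ∈ Finset.Icc 1 k, ((j : ℝ) - m + 1) * (j + m) / (m : ℝ) ^ 2) = P₁
  generalize (∏ m ∈ Finset.Icc 1 k, (1 / 2 - H + m - 1)) = P₂
  generalize (∏ m ∈ Finset.Icc 1 k, (m : ℝ)) = P₃
  generalize (∏ m ∈ Finset.Icc 1 k,
    (H + 1 / 2 + m) ^ 2 / ((H + 1 / 2 - i + m) * (H + 1 / 2 + i + m + 1))) = P₄
  generalize Fcoef T (H + 1 / 2) i = F, Real.Gamma (1 / 2 - H) = G, T ^ k = X at *
  simp only [div_eq_mul_inv, mul_inv]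
  linear_combination (aH H * Real.sqrt ((2 * j + 1) * T⁻¹) * (-1) ^ (j - k) * P₁ * G *
    (1 * 2⁻¹ - H + k) * P₂ * P₃⁻¹ * (H + 1 * 2⁻¹ + k)⁻¹ * F * P₄) * hTk
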